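/- Let Γ be a countable discrete group, ρ an IRE on Γ, Ξ a nonempty Polish space with a topologically amenable continuous action of Γ, and suppose there exists a classwise coherent Ξ-marking of ρ. Then ρ is an amenable IRE. -/

import Mathlib

open MeasureTheory Filter Topology

/-- A function `r : Γ × Γ → Bool` codes an equivalence relation on `Γ`. -/
def IsEqRel {Γ : Type*} (r : Γ × Γ → Bool) : Prop :=
  (∀ x, r (x, x) = true) ∧ (∀ x y, r (x, y) = true → r (y, x) = true) ∧
    (∀ x y z, r (x, y) = true → r (y, z) = true → r (x, z) = true)

/-- The space `E` of equivalence relations on `Γ`, as a subspace of `{0,1}^{Γ×Γ}`. -/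
abbrev EqRelSpace (Γ : Type*) : Type _ := ↥{r : Γ × Γ → Bool | IsEqRel r}

variable {Γ : Type*} [Group Γ]

/-- The left shift action of `Γ` on the space of equivalence relations:
`(γ·r)(x,y) = r(γ⁻¹x, γ⁻¹y)`. -/
def shiftE (γ : Γ) (r : EqRelSpace Γ) : EqRelSpace Γ :=
  ⟨fun p => r.1 (γ⁻¹ * p.1, γ⁻¹ * p.2),
    ⟨fun _ => r.2.1 _, fun _ _ h => r.2.2.1 _ _ h, fun _ _ _ h h' => r.2.2.2 _ _ _ h h'⟩⟩

/-- The `r`-class of `g ∈ Γ`. -/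
def classOf (r : EqRelSpace Γ) (g : Γ) : Set Γ := {h | r.1 (g, h) = true}

/-- An invariant random equivalence relation: a Borel probability measure on `E`
invariant under the left shift action. -/
def IsIRE (ρ : ProbabilityMeasure (EqRelSpace Γ)) : Prop :=
  ∀ γ : Γ, ρ.toMeasure.map (shiftE γ) = ρ.toMeasure

/-- Topological amenability of an action `a : Γ → X → X` on a topological space:
there are continuous maps `η_n : X → Prob(Γ)` (coded coordinatewise) with
`sup_x ‖γ·η_n^x − η_n^{γ·x}‖₁ → 0` for every `γ`; here `(γ·η)(g) = η(γ⁻¹g)`. -/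
def TopAmenableAction (Γ : Type*) [Group Γ] {X : Type*} [TopologicalSpace X]
    (a : Γ → X → X) : Prop :=
  ∃ η : ℕ → X → Γ → ℝ,
    (∀ n x g, 0 ≤ η n x g) ∧
    (∀ n x, ∑' g, η n x g = 1) ∧
    (∀ n g, Continuous fun x => η n x g) ∧
    ∀ γ : Γ, ∀ ε > (0 : ℝ), ∃ N, ∀ n ≥ N, ∀ x : X,
      ∑' g : Γ, |η n x (γ⁻¹ * g) - η n (a γ x) g| < ε

/-- A classwise coherent `Ξ`-marking of an IRE `ρ`, for an action `a : Γ → Ξ → Ξ`: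
a `Γ`-invariant Borel probability measure on `E × Ξ^Γ` (for the diagonal action, where
`Γ` acts on `Ξ^Γ` by `(γ·f)(x) = f(γ⁻¹x)`) projecting to `ρ`, such that almost surely
`g·(f(g)) = h·(f(h))` for every pair `(g,h)` in the relation. -/
def IsCCMarking {Γ : Type*} [Group Γ] {Ξ : Type*} [MeasurableSpace Ξ] (a : Γ → Ξ → Ξ)
    (ρ : ProbabilityMeasure (EqRelSpace Γ))
    (ρ' : ProbabilityMeasure (EqRelSpace Γ × (Γ → Ξ))) : Prop :=
  (∀ γ : Γ, ρ'.toMeasure.map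
      (fun p => (shiftE γ p.1, fun x => p.2 (γ⁻¹ * x))) = ρ'.toMeasure) ∧
  ρ'.toMeasure.map Prod.fst = ρ.toMeasure ∧
  ∀ᵐ p ∂ρ'.toMeasure, ∀ g h : Γ, p.1.1 (g, h) = true → a g (p.2 g) = a h (p.2 h)

/-- An amenable IRE: there are Borel maps `λ_n : E → Prob(Γ)` (coded coordinatewise as
`lam : ℕ → E → Γ → ℝ`) such that for a.e. `r` and every `g` in the class of the identity,
`‖g⁻¹·λ_n^r − λ_n^{g⁻¹·r}‖₁ → 0`; here `(g⁻¹·λ_n^r)(h) = λ_n^r(gh)`. -/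
def IsAIRE {Γ : Type*} [Group Γ] (ρ : ProbabilityMeasure (EqRelSpace Γ)) : Prop :=
  IsIRE ρ ∧ ∃ lam : ℕ → EqRelSpace Γ → Γ → ℝ,
    (∀ n g, Measurable fun r => lam n r g) ∧
    (∀ n r g, 0 ≤ lam n r g) ∧
    (∀ n r, ∑' g, lam n r g = 1) ∧
    ∀ᵐ r ∂ρ.toMeasure, ∀ g ∈ classOf r 1,
      Tendsto (fun n => ∑' h : Γ, |lam n r (g * h) - lam n (shiftE g⁻¹ r) h|) atTop (𝓝 0)

open ProbabilityTheory

lemma measurable_shiftE (γ : Γ) : Measurable (shiftE γ : EqRelSpace Γ → EqRelSpace Γ) := by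
  refine Measurable.subtype_mk (measurable_pi_lambda _ fun p => ?_)
  exact (measurable_pi_apply (γ⁻¹ * p.1, γ⁻¹ * p.2)).comp measurable_subtype_coe

lemma shiftE_shiftE_inv (γ : Γ) (r : EqRelSpace Γ) : shiftE γ (shiftE γ⁻¹ r) = r := by
  apply Subtype.ext
  funext p
  simp [shiftE]

lemma measurableSet_mem_classOf {Γ : Type*} (g h : Γ) :
    MeasurableSet {r : EqRelSpace Γ | h ∈ classOf r g} := by
  have hm : Measurable fun r : EqRelSpace Γ => r.1 (g, h) :=
    (measurable_pi_apply (g, h)).comp measurable_subtype_coe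
  exact hm (measurableSet_singleton true)

lemma summable_of_tsum_eq_one {ι : Type*} {f : ι → ℝ} (h : ∑' i, f i = 1) : Summable f := by
  by_contra hf
  rw [tsum_eq_zero_of_not_summable hf] at h
  exact zero_ne_one h

lemma le_one_of_tsum_eq_one {ι : Type*} {f : ι → ℝ} (h0 : ∀ i, 0 ≤ f i) (h : ∑' i, f i = 1)
    (i : ι) : f i ≤ 1 :=
  h ▸ (summable_of_tsum_eq_one h).le_tsum i fun j _ => h0 j

/-- Averaging a measurable family of probability vectors gives a probability vector. -/
lemma tsum_integral_eq_one {X ι : Type*} [MeasurableSpace X] [Countable ι] (μ : Measure X)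
    [IsProbabilityMeasure μ] {F : X → ι → ℝ} (h0 : ∀ x i, 0 ≤ F x i)
    (h1 : ∀ x, ∑' i, F x i = 1) (hFint : ∀ i, Integrable (fun x => F x i) μ) :
    ∑' i, ∫ x, F x i ∂μ = 1 := by
  have hsum : Summable fun i => ∫ x, ‖F x i‖ ∂μ := by
    refine summable_of_sum_le (c := 1) (fun i => integral_nonneg fun x => norm_nonneg _) fun s => ?_
    rw [← integral_finsetSum s fun i _ => (hFint i).norm]
    calc ∫ x, ∑ i ∈ s, ‖F x i‖ ∂μ ≤ ∫ _, (1 : ℝ) ∂μ := by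
          refine integral_mono (integrable_finsetSum _ fun i _ => (hFint i).norm)
            (integrable_const _) fun x => ?_
          simp only [Real.norm_of_nonneg (h0 x _)]
          exact h1 x ▸ (summable_of_tsum_eq_one (h1 x)).sum_le_tsum s fun i _ => h0 x i
      _ = 1 := by simp
  rw [(hasSum_integral_of_summable_integral_norm (F := fun i x => F x i) hFint hsum).tsum_eq]
  simp [h1]

/-- The `ℓ¹` distance of averages is at most a uniform bound on the `ℓ¹` distances. -/
lemma tsum_abs_integral_sub_integral_le {X ι : Type*} [MeasurableSpace X] (μ : Measure X)
    [IsProbabilityMeasure μ] {F G : X → ι → ℝ} {ε : ℝ}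
    (hF : ∀ i, Integrable (fun x => F x i) μ) (hG : ∀ i, Integrable (fun x => G x i) μ)
    (hsum : ∀ x, Summable fun i => |F x i - G x i|) (hle : ∀ x, ∑' i, |F x i - G x i| ≤ ε) :
    ∑' i, |∫ x, F x i ∂μ - ∫ x, G x i ∂μ| ≤ ε := by
  refine Real.tsum_le_of_sum_le (fun i => abs_nonneg _) fun s => ?_
  have hFint : ∀ i, Integrable (fun x => |F x i - G x i|) μ := fun i => ((hF i).sub (hG i)).abs
  calc ∑ i ∈ s, |∫ x, F x i ∂μ - ∫ x, G x i ∂μ|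
      ≤ ∑ i ∈ s, ∫ x, |F x i - G x i| ∂μ := by
        refine Finset.sum_le_sum fun i _ => ?_
        rw [← integral_sub (hF i) (hG i)]
        exact abs_integral_le_integral_abs
    _ = ∫ x, ∑ i ∈ s, |F x i - G x i| ∂μ := (integral_finsetSum s fun i _ => hFint i).symm
    _ ≤ ∫ _, ε ∂μ := by
        refine integral_mono (integrable_finsetSum _ fun i _ => hFint i)
          (integrable_const _) fun x => ?_
        exact ((hsum x).sum_le_tsum s fun i _ => abs_nonneg _).trans (hle x)
    _ = ε := by simp

/-- The joint law of the relation and of the mark at the identity. -/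
noncomputable def markLaw {Ξ : Type*} [MeasurableSpace Ξ]
    (ρ' : ProbabilityMeasure (EqRelSpace Γ × (Γ → Ξ))) : Measure (EqRelSpace Γ × Ξ) :=
  ρ'.toMeasure.map fun p => (p.1, p.2 1)

lemma measurable_fst_mark {Γ Ξ : Type*} [MeasurableSpace Ξ] (g : Γ) :
    Measurable fun p : EqRelSpace Γ × (Γ → Ξ) => (p.1, p.2 g) :=
  measurable_fst.prodMk ((measurable_pi_apply g).comp measurable_snd)

instance {Ξ : Type*} [MeasurableSpace Ξ]
    (ρ' : ProbabilityMeasure (EqRelSpace Γ × (Γ → Ξ))) : IsProbabilityMeasure (markLaw ρ') :=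
  Measure.isProbabilityMeasure_map (measurable_fst_mark 1).aemeasurable

/-- The conditional law of the mark at the identity given the relation is equivariant along the
class of the identity. -/
lemma condKernel_markLaw_shiftE {Ξ : Type*} [MeasurableSpace Ξ] [StandardBorelSpace Ξ] [Nonempty Ξ]
    {a : Γ → Ξ → Ξ} (hone : ∀ x, a 1 x = x) (hmul : ∀ γ δ x, a (γ * δ) x = a γ (a δ x))
    (ha : ∀ γ, Measurable (a γ)) {ρ : ProbabilityMeasure (EqRelSpace Γ)} (hρ : IsIRE ρ)
    {ρ' : ProbabilityMeasure (EqRelSpace Γ × (Γ → Ξ))} (hρ' : IsCCMarking a ρ ρ') (g : Γ) :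
    ∀ᵐ r ∂ρ.toMeasure, g ∈ classOf r 1 →
      (markLaw ρ').condKernel (shiftE g⁻¹ r) = ((markLaw ρ').condKernel r).map (a g⁻¹) := by
  obtain ⟨hinv, hfst, hcoh⟩ := hρ'
  set K := (markLaw ρ').condKernel
  have hdis : ρ.toMeasure ⊗ₘ K = markLaw ρ' := by
    have h := (markLaw ρ').disintegrate K
    rwa [Measure.fst, markLaw, Measure.map_map measurable_fst (measurable_fst_mark 1),
      show (Prod.fst ∘ fun p : EqRelSpace Γ × (Γ → Ξ) => (p.1, p.2 1)) = Prod.fst from rfl,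
      hfst] at h
  have hrect : ∀ {A : Set (EqRelSpace Γ)} {B : Set Ξ}, MeasurableSet A → MeasurableSet B →
      ∫⁻ r in A, K r B ∂ρ.toMeasure = ρ'.toMeasure {p | p.1 ∈ A ∧ p.2 1 ∈ B} := by
    intro A B hA hB
    rw [← Measure.compProd_apply_prod hA hB, hdis, markLaw,
      Measure.map_apply (measurable_fst_mark 1) (hA.prod hB)]
    rfl
  have hC := measurableSet_mem_classOf (1 : Γ) g
  have key : K.comap (shiftE g⁻¹) (measurable_shiftE g⁻¹)
      =ᵐ[ρ.toMeasure.restrict {r | g ∈ classOf r 1}] K.map (a g⁻¹) := by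
    have : IsMarkovKernel (K.map (a g⁻¹)) := Kernel.IsMarkovKernel.map K (ha g⁻¹)
    refine Kernel.ae_eq_of_compProd_eq (Measure.ext_prod fun {A B} hA hB => ?_)
    rw [Measure.compProd_apply_prod hA hB, Measure.compProd_apply_prod hA hB,
      Measure.restrict_restrict hA]
    have hD := hA.inter hC
    set D := A ∩ {r : EqRelSpace Γ | g ∈ classOf r 1}
    have hD' : MeasurableSet (shiftE g ⁻¹' D) := measurable_shiftE g hD
    have hpre : shiftE g⁻¹ ⁻¹' (shiftE g ⁻¹' D) = D := by
      ext r
      simp [shiftE_shiftE_inv]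
    calc ∫⁻ r in D, K.comap (shiftE g⁻¹) (measurable_shiftE g⁻¹) r B ∂ρ.toMeasure
        = ∫⁻ r in shiftE g ⁻¹' D, K r B ∂ρ.toMeasure := by
          conv_rhs => rw [← hρ g⁻¹]
          rw [setLIntegral_map hD' (K.measurable_coe hB) (measurable_shiftE g⁻¹), hpre]
          rfl
      _ = ρ'.toMeasure {p | p.1 ∈ shiftE g ⁻¹' D ∧ p.2 1 ∈ B} := hrect hD' hB
      _ = ρ'.toMeasure {p | p.1 ∈ D ∧ p.2 g ∈ B} := by
          have hT : Measurable fun p : EqRelSpace Γ × (Γ → Ξ) =>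
              (shiftE g⁻¹ p.1, fun x => p.2 ((g⁻¹)⁻¹ * x)) :=
            ((measurable_shiftE g⁻¹).comp measurable_fst).prodMk
              (measurable_pi_lambda _ fun x =>
                (measurable_pi_apply ((g⁻¹)⁻¹ * x)).comp measurable_snd)
          conv_lhs => rw [← hinv g⁻¹]
          have hE : MeasurableSet {p : EqRelSpace Γ × (Γ → Ξ) |
              p.1 ∈ shiftE g ⁻¹' D ∧ p.2 1 ∈ B} := measurable_fst_mark 1 (hD'.prod hB)
          rw [Measure.map_apply hT hE]
          congr 1
          ext p
          simp [shiftE_shiftE_inv]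
      _ = ρ'.toMeasure {p | p.1 ∈ D ∧ p.2 1 ∈ a g⁻¹ ⁻¹' B} := by
          refine measure_congr ?_
          filter_upwards [hcoh] with p hp
          refine propext (and_congr_right fun hpD => ?_)
          have h1 : a g⁻¹ (p.2 1) = p.2 g := by
            have h := hp 1 g hpD.2
            rw [hone] at h
            rw [h, ← hmul, inv_mul_cancel, hone]
          change p.2 g ∈ B ↔ a g⁻¹ (p.2 1) ∈ B
          rw [h1]
      _ = ∫⁻ r in D, K.map (a g⁻¹) r B ∂ρ.toMeasure := by
          rw [← hrect hD (ha g⁻¹ hB)]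
          simp_rw [Kernel.map_apply' K (ha g⁻¹) _ hB]
  filter_upwards [(ae_restrict_iff' hC).1 key] with r hr hg
  have hr := hr hg
  rwa [Kernel.comap_apply, Kernel.map_apply K (ha g⁻¹)] at hr

/-- Proposition: an IRE admitting a classwise coherent marking by a topologically amenable
action on a nonempty Polish space is an amenable IRE. -/
theorem AIRE_of_CCMarking
    {Γ : Type*} [Group Γ] [Countable Γ]
    {Ξ : Type*} [TopologicalSpace Ξ] [PolishSpace Ξ] [MeasurableSpace Ξ] [BorelSpace Ξ]
    [Nonempty Ξ]
    (a : Γ → Ξ → Ξ)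
    (hone : ∀ x, a 1 x = x) (hmul : ∀ γ δ x, a (γ * δ) x = a γ (a δ x))
    (hcont : ∀ γ, Continuous (a γ)) (hta : TopAmenableAction Γ a)
    (ρ : ProbabilityMeasure (EqRelSpace Γ)) (hρ : IsIRE ρ)
    (hmark : ∃ ρ' : ProbabilityMeasure (EqRelSpace Γ × (Γ → Ξ)), IsCCMarking a ρ ρ') :
    IsAIRE ρ := by
  obtain ⟨ρ', hρ'⟩ := hmark
  obtain ⟨η, hη0, hη1, hηc, hη⟩ := hta
  set K := (markLaw ρ').condKernel
  have hFint : ∀ (μ : Measure Ξ) [IsProbabilityMeasure μ] (n : ℕ) (g : Γ),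
      Integrable (fun x => η n x g) μ := by
    intro μ _ n g
    refine Integrable.of_bound (hηc n g).measurable.aestronglyMeasurable 1
      (Eventually.of_forall fun x => ?_)
    rw [Real.norm_of_nonneg (hη0 n x g)]
    exact le_one_of_tsum_eq_one (hη0 n x) (hη1 n x) g
  refine ⟨hρ, fun n r g => ∫ x, η n x g ∂(K r), fun n g => ?_,
    fun n r g => integral_nonneg fun x => hη0 n x g,
    fun n r => tsum_integral_eq_one (K r) (hη0 n) (hη1 n) (hFint (K r) n), ?_⟩
  · exact ((hηc n g).measurable.stronglyMeasurable.integral_kernel (κ := K)).measurable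
  have hequiv := ae_all_iff.2 fun g =>
    condKernel_markLaw_shiftE hone hmul (fun γ => (hcont γ).measurable) hρ hρ' g
  filter_upwards [hequiv] with r hr g hg
  have hKr := hr g hg
  have hga : Measurable (a g⁻¹) := (hcont g⁻¹).measurable
  have : IsProbabilityMeasure ((K r).map (a g⁻¹)) :=
    Measure.isProbabilityMeasure_map hga.aemeasurable
  rw [Metric.tendsto_atTop]
  intro ε hε
  obtain ⟨N, hN⟩ := hη g⁻¹ (ε / 2) (half_pos hε)
  refine ⟨N, fun n hn => ?_⟩
  rw [Real.dist_0_eq_abs, abs_of_nonneg (tsum_nonneg fun _ => abs_nonneg _)]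
  refine lt_of_le_of_lt ?_ (half_lt_self hε)
  have hmap : ∀ h, ∫ x, η n x h ∂(K (shiftE g⁻¹ r)) = ∫ x, η n (a g⁻¹ x) h ∂(K r) := by
    intro h
    rw [hKr, integral_map hga.aemeasurable (hηc n h).measurable.aestronglyMeasurable]
  simp_rw [hmap]
  refine tsum_abs_integral_sub_integral_le (K r) (F := fun x h => η n x (g * h))
    (G := fun x h => η n (a g⁻¹ x) h) (fun h => hFint (K r) n (g * h))
    (fun h => (hFint ((K r).map (a g⁻¹)) n h).comp_measurable hga) (fun x => ?_) fun x => ?_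
  · exact (((summable_of_tsum_eq_one (hη1 n x)).comp_injective (mul_right_injective g)).sub
      (summable_of_tsum_eq_one (hη1 n (a g⁻¹ x)))).abs
  · have h := (hN n hn x).le
    rwa [inv_inv] at h
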